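/- Let J be a symmetric 3×3 real matrix, G a symmetric 3×3 real matrix, R_d a 3×3 real matrix, and k_D ∈ ℝ. Let R : ℝ → Matrix(3,3,ℝ) and ω : ℝ → ℝ³ be differentiable and a : ℝ → ℝ³ arbitrary, satisfying R'(t) = R(t)·ω̃(t) and J·ω'(t) = −ω(t) × (J·ω(t) − a(t)) + τ'(t), where, writing M(t) = G·R_dᵀ·R(t), the control torque is τ'(t) = (−(M₃₂ − M₂₃) − k_D·ω₁, −(M₁₃ − M₃₁) − k_D·ω₂, −(M₂₁ − M₁₂) − k_D·ω₃)(t). Then the Lyapunov function V(t) = (1/2)·⟨ω(t), J·ω(t)⟩ − trace(G·(R_dᵀ·R(t) − I₃)) satisfies V'(t) = −k_D·‖ω(t)‖² for all t; in particular, if k_D ≥ 0 then V is nonincreasing, for any choice of the gyroscopic term a. -/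

import Mathlib

open Matrix

attribute [local instance] Matrix.normedAddCommGroup Matrix.normedSpace

/-- The hat map: `hat ω` is the skew-symmetric matrix with `(hat ω) ⬝ᵥ b = ω × b`. -/
def hat (ω : Fin 3 → ℝ) : Matrix (Fin 3) (Fin 3) ℝ :=
  !![0, -ω 2, ω 1; ω 2, 0, -ω 0; -ω 1, ω 0, 0]

theorem Matrix.trace_mul_hat (M : Matrix (Fin 3) (Fin 3) ℝ) (w : Fin 3 → ℝ) :
    (M * hat w).trace =
      -(w ⬝ᵥ ![M 2 1 - M 1 2, M 0 2 - M 2 0, M 1 0 - M 0 1]) := by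
  simp [hat, Matrix.trace, Matrix.mul_apply, dotProduct, Fin.sum_univ_three]
  ring

theorem HasDerivAt.matrix_trace_mul {n : Type*} [Fintype n] (A : Matrix n n ℝ)
    {X : ℝ → Matrix n n ℝ} {X' : Matrix n n ℝ} {t : ℝ} (hX : HasDerivAt X X' t) :
    HasDerivAt (fun s => (A * X s).trace) (A * X').trace t := by
  have hentry (i j : n) : HasDerivAt (fun s => X s i j) (X' i j) t :=
    hasDerivAt_pi.1 (hasDerivAt_pi.1 hX i) j
  simp only [Matrix.trace, Matrix.diag, Matrix.mul_apply]
  exact HasDerivAt.fun_sum fun i _ => HasDerivAt.fun_sum fun j _ => (hentry j i).const_mul _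

theorem HasDerivAt.half_dotProduct_mulVec {n : Type*} [Fintype n] {J : Matrix n n ℝ}
    (hJ : J.IsSymm) {x : ℝ → n → ℝ} {x' : n → ℝ} {t : ℝ} (hx : HasDerivAt x x' t) :
    HasDerivAt (fun s => (1 / 2) * (x s ⬝ᵥ J *ᵥ x s)) (x t ⬝ᵥ J *ᵥ x') t := by
  have hcoord (i : n) : HasDerivAt (fun s => x s i) (x' i) t := hasDerivAt_pi.1 hx i
  have hJx (i : n) : HasDerivAt (fun s => (J *ᵥ x s) i) ((J *ᵥ x') i) t :=
    HasDerivAt.fun_sum fun j _ => (hcoord j).const_mul _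
  have hsum : HasDerivAt (fun s => x s ⬝ᵥ J *ᵥ x s)
      (x' ⬝ᵥ J *ᵥ x t + x t ⬝ᵥ J *ᵥ x') t := by
    simp only [dotProduct, ← Finset.sum_add_distrib]
    exact HasDerivAt.fun_sum fun i _ => (hcoord i).fun_mul (hJx i)
  have hsymm : x' ⬝ᵥ J *ᵥ x t = x t ⬝ᵥ J *ᵥ x' := by
    rw [dotProduct_mulVec, ← mulVec_transpose, hJ.eq, dotProduct_comm]
  refine (hsum.const_mul (1 / 2)).congr_deriv ?_
  rw [hsymm]
  ring

/-- Closed-loop rotational dynamics `Ṙ = R·ω̃`,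
`J·ω̇ = −ω × (J·ω − a) + τ'` with the nominal attitude controller
`τ' = −2·sk(G·R_dᵀ·R)^∨ − k_D·ω` (written componentwise with `M = G·R_dᵀ·R`):
the Lyapunov function `V = (1/2)·⟨ω, J·ω⟩ − trace(G·(R_dᵀ·R − I₃))` satisfies
`V' = −k_D·‖ω‖²`; in particular, if `k_D ≥ 0` then `V` is nonincreasing, for any
choice of the gyroscopic term `a`. -/
theorem stmt10
    (J G Rd : Matrix (Fin 3) (Fin 3) ℝ) (hJ : J.IsSymm) (hG : G.IsSymm) (kD : ℝ)
    (R : ℝ → Matrix (Fin 3) (Fin 3) ℝ)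
    (ω ω' : ℝ → EuclideanSpace ℝ (Fin 3))
    (a τ' : ℝ → Fin 3 → ℝ)
    (hτ : ∀ t, τ' t =
      ![-((G * Rdᵀ * R t) 2 1 - (G * Rdᵀ * R t) 1 2) - kD * ω t 0,
        -((G * Rdᵀ * R t) 0 2 - (G * Rdᵀ * R t) 2 0) - kD * ω t 1,
        -((G * Rdᵀ * R t) 1 0 - (G * Rdᵀ * R t) 0 1) - kD * ω t 2])
    (hR : ∀ t, HasDerivAt R (R t * hat (ω t)) t)
    (hω : ∀ t, HasDerivAt ω (ω' t) t)
    (hdyn : ∀ t, J.mulVec (ω' t) =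
      -(crossProduct (ω t) (J.mulVec (ω t) - a t)) + τ' t) :
    (∀ t, HasDerivAt
        (fun s => (1/2) * (ω s ⬝ᵥ J.mulVec (ω s)) - (G * (Rdᵀ * R s - 1)).trace)
        (-kD * ‖ω t‖ ^ 2) t) ∧
    (0 ≤ kD → Antitone
        (fun s => (1/2) * (ω s ⬝ᵥ J.mulVec (ω s)) - (G * (Rdᵀ * R s - 1)).trace)) := by
  have hV : ∀ t, HasDerivAt
      (fun s => (1/2) * (ω s ⬝ᵥ J.mulVec (ω s)) - (G * (Rdᵀ * R s - 1)).trace)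
      (-kD * ‖ω t‖ ^ 2) t := by
    intro t
    have hcoord : HasDerivAt (fun s => (ω s : Fin 3 → ℝ)) (ω' t) t :=
      (EuclideanSpace.equiv (Fin 3) ℝ).hasFDerivAt.comp_hasDerivAt t (hω t)
    have hkin := hcoord.half_dotProduct_mulVec hJ
    have hpot := ((hR t).matrix_trace_mul (G * Rdᵀ)).sub_const G.trace
    have htrace (s : ℝ) : (G * (Rdᵀ * R s - 1)).trace = (G * Rdᵀ * R s).trace - G.trace := by
      simp [Matrix.mul_sub, Matrix.mul_assoc]
    simp only [htrace]
    refine (hkin.fun_sub hpot).congr_deriv ?_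
    rw [hdyn t, dotProduct_add, dotProduct_neg, dot_self_cross, hτ t, ← Matrix.mul_assoc,
      Matrix.trace_mul_hat, EuclideanSpace.real_norm_sq_eq]
    simp only [dotProduct, Fin.sum_univ_three, Matrix.cons_val]
    ring
  refine ⟨hV, fun hk => antitone_of_hasDerivAt_nonpos hV fun t => ?_⟩
  exact mul_nonpos_of_nonpos_of_nonneg (neg_nonpos.2 hk) (sq_nonneg _)
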